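/- Let A = F₂[a,b,c]/(ab,bc) with a, b, c in degree 1. The graded Hochschild cohomology group HH^{3,−1}(A) vanishes. Concretely: in the reduced Hochschild cochain complex, consider the F₂-linear maps of internal degree −1 (i.e., maps lowering the grading by 1), with differential ∂(f)(a₁⊗⋯⊗a_{n+1}) = a₁f(a₂⊗⋯⊗a_{n+1}) + Σ_{i=1}^{n} f(a₁⊗⋯⊗a_i a_{i+1}⊗⋯⊗a_{n+1}) + f(a₁⊗⋯⊗aₙ)a_{n+1}. Then the sequence Hom_{F₂}(A^{⊗2}, A)_{−1} → Hom_{F₂}(A^{⊗3}, A)_{−1} → Hom_{F₂}(A^{⊗4}, A)_{−1} is exact at the middle term: every degree-(−1) graded map f: A^{⊗3} → A with ∂f = 0 is of the form ∂g for some degree-(−1) graded map g: A^{⊗2} → A. -/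

import Mathlib

open TensorProduct

/-- The field `F₂`. -/
abbrev Ftwo := ZMod 2

/-- The polynomial ring `F₂[a,b,c]` (generators `X 0, X 1, X 2` in degree one). -/
abbrev Apoly := MvPolynomial (Fin 3) Ftwo

/-- The ideal `(ab, bc)`. -/
noncomputable def Irel : Ideal Apoly :=
  Ideal.span {MvPolynomial.X 0 * MvPolynomial.X 1, MvPolynomial.X 1 * MvPolynomial.X 2}

/-- The algebra `A = F₂[a,b,c]/(ab,bc)`. -/
abbrev Aalg := Apoly ⧸ Irel

/-- The grading of `A = F₂[a,b,c]/(ab,bc)`: `AG n` is the image in `A` of the space of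
homogeneous polynomials of degree `n` (and `⊥` for `n < 0`). -/
noncomputable def AG (n : ℤ) : Submodule Ftwo Aalg :=
  if 0 ≤ n then
    Submodule.map (Ideal.Quotient.mkₐ Ftwo Irel).toLinearMap
      (MvPolynomial.homogeneousSubmodule (Fin 3) Ftwo n.toNat)
  else ⊥

section PathAlgebra

variable {A : Type*} [CommRing A] [Algebra (ZMod 2) A]

/-- The monomials of `F₂[a,b,c]/(ab,bc)`: `inl (i, j)` is `aⁱcʲ` and `inr k` is `bᵏ⁺¹`. -/
def pathMonomial (a b c : A) : (ℕ × ℕ) ⊕ ℕ → A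
  | .inl (i, j) => a ^ i * c ^ j
  | .inr k => b ^ (k + 1)

/-- The degree of a monomial of `F₂[a,b,c]/(ab,bc)`. -/
def pathDegree : (ℕ × ℕ) ⊕ ℕ → ℕ
  | .inl (i, j) => i + j
  | .inr k => k + 1

/-- The condition `∂D = 0` on a Hochschild 3-cochain `D` in characteristic two. -/
def IsHochschildCocycle (D : A →ₗ[ZMod 2] A →ₗ[ZMod 2] A →ₗ[ZMod 2] A) : Prop :=
  ∀ x y z w, x * D y z w + D (x * y) z w + D x (y * z) w + D x y (z * w) + D x y z * w = 0

/-- A Hochschild 3-cochain is normalized if it vanishes when one argument is `1`. -/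
structure IsNormalizedCochain (D : A →ₗ[ZMod 2] A →ₗ[ZMod 2] A →ₗ[ZMod 2] A) : Prop where
  left (y z : A) : D 1 y z = 0
  mid (x z : A) : D x 1 z = 0
  right (x y : A) : D x y 1 = 0

/-- The Hochschild differential of a 2-cochain in characteristic two. -/
def hochschildD (g : A →ₗ[ZMod 2] A →ₗ[ZMod 2] A) :
    A →ₗ[ZMod 2] A →ₗ[ZMod 2] A →ₗ[ZMod 2] A :=
  LinearMap.mk₂ (ZMod 2)
    (fun x y => LinearMap.mulLeft (ZMod 2) x ∘ₗ g y + g (x * y)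
      + g x ∘ₗ LinearMap.mulLeft (ZMod 2) y + LinearMap.mulLeft (ZMod 2) (g x y))
    (fun x x' y => by ext z; simp [add_mul]; ring)
    (fun r x y => by ext z; simp)
    (fun x y y' => by ext z; simp [add_mul, mul_add]; ring)
    (fun r x y => by ext z; simp)

@[simp]
lemma hochschildD_apply (g : A →ₗ[ZMod 2] A →ₗ[ZMod 2] A) (x y z : A) :
    hochschildD g x y z = x * g y z + g (x * y) z + g x (y * z) + g x y * z := by
  simp [hochschildD]

lemma IsHochschildCocycle.add_hochschildD [CharP A 2]
    {f : A →ₗ[ZMod 2] A →ₗ[ZMod 2] A →ₗ[ZMod 2] A} (hf : IsHochschildCocycle f)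
    (g : A →ₗ[ZMod 2] A →ₗ[ZMod 2] A) : IsHochschildCocycle (f + hochschildD g) := by
  intro x y z w
  have := hf x y z w
  simp only [LinearMap.add_apply, hochschildD_apply, mul_assoc]
  grind

lemma IsHochschildCocycle.eq_zero_of_generators
    {D : A →ₗ[ZMod 2] A →ₗ[ZMod 2] A →ₗ[ZMod 2] A} (hD : IsHochschildCocycle D)
    {a b c : A} (e : Module.Basis ((ℕ × ℕ) ⊕ ℕ) (ZMod 2) A) (he : ∀ m, e m = pathMonomial a b c m)
    (h1 : D 1 = 0) (ha : D a = 0) (hb : D b = 0) (hc : D c = 0) : D = 0 := by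
  have hmul : ∀ x y, D x = 0 → D y = 0 → D (x * y) = 0 := by
    intro x y hx hy
    ext z w
    have := hD x y z w
    simpa [hx, hy] using this
  have hpow : ∀ x, D x = 0 → ∀ n : ℕ, D (x ^ n) = 0 := by
    intro x hx n
    induction n with
    | zero => simpa using h1
    | succ n ih => rw [pow_succ]; exact hmul _ _ ih hx
  refine e.ext fun m => ?_
  rw [he]
  rcases m with ⟨i, j⟩ | k
  · exact hmul _ _ (hpow a ha i) (hpow c hc j)
  · exact hpow b hb _

/-- A linear map vanishing on the monomials `aⁱcʲ` and `bᵏ` is zero. -/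
lemma linearMap_eq_zero_of_monomials {M : Type*} [AddCommMonoid M] [Module (ZMod 2) M]
    {a b c : A} (e : Module.Basis ((ℕ × ℕ) ⊕ ℕ) (ZMod 2) A) (he : ∀ m, e m = pathMonomial a b c m)
    {φ : A →ₗ[ZMod 2] M} (hac : ∀ i j : ℕ, φ (a ^ i * c ^ j) = 0) (hb : ∀ k : ℕ, φ (b ^ k) = 0) :
    φ = 0 := by
  refine e.ext fun m => ?_
  rw [he]
  rcases m with ⟨i, j⟩ | k
  · exact hac i j
  · exact hb _

/-- A normalized Hochschild 3-cocycle of `F₂[a,b,c]/(ab,bc)` is zero if it vanishes on the cells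
`(ℓ, m, z)` with `ℓ m` a normal word, on the cells `(ℓ, ℓ', m)` with `ℓ ℓ'` not normal and `ℓ' m`
normal, and on the words of length three all of whose subwords of length two are not normal. -/
lemma IsHochschildCocycle.eq_zero_of_cells
    {D : A →ₗ[ZMod 2] A →ₗ[ZMod 2] A →ₗ[ZMod 2] A} (hD : IsHochschildCocycle D)
    (hN : IsNormalizedCochain D)
    {a b c : A} (hab : a * b = 0) (hbc : b * c = 0)
    (e : Module.Basis ((ℕ × ℕ) ⊕ ℕ) (ZMod 2) A) (he : ∀ m, e m = pathMonomial a b c m)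
    (haa : ∀ (i j : ℕ) z, D a (a ^ i * c ^ j) z = 0)
    (hcc : ∀ (j : ℕ) z, D c (c ^ j) z = 0)
    (hbb : ∀ (k : ℕ) z, D b (b ^ k) z = 0)
    (habb : ∀ k : ℕ, D a b (b ^ k) = 0)
    (hcbb : ∀ k : ℕ, D c b (b ^ k) = 0)
    (hbaa : ∀ i j : ℕ, D b a (a ^ i * c ^ j) = 0)
    (hbcc : ∀ j : ℕ, D b c (c ^ j) = 0)
    (hcaa : ∀ i j : ℕ, D c a (a ^ i * c ^ j) = 0)
    (haba : D a b a = 0) (habc : D a b c = 0) (hcba : D c b a = 0) (hcbc : D c b c = 0)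
    (hbab : D b a b = 0) (hbcb : D b c b = 0) (hbca : D b c a = 0) (hcab : D c a b = 0) :
    D = 0 := by
  have hba : b * a = 0 := by rw [mul_comm, hab]
  have hcb : c * b = 0 := by rw [mul_comm, hbc]
  have hca : c * a = a * c := mul_comm c a
  -- the monomial `aⁱcʲ` starts with `1`, with `a` or with `c`
  have cases_ac : ∀ P : A → Prop, P 1 → (∀ i j : ℕ, P (a * (a ^ i * c ^ j))) →
      (∀ j : ℕ, P (c * c ^ j)) → ∀ i j : ℕ, P (a ^ i * c ^ j) := by
    intro P h1 ha hc i j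
    rcases i with _ | i
    · rcases j with _ | j
      · simpa using h1
      · simpa [pow_succ'] using hc j
    · have := ha i j
      rwa [← mul_assoc, ← pow_succ'] at this
  have cases_b : ∀ P : A → Prop, P 1 → (∀ k : ℕ, P (b * b ^ k)) → ∀ k : ℕ, P (b ^ k) := by
    intro P h1 hb k
    rcases k with _ | k
    · simpa using h1
    · simpa [pow_succ'] using hb k
  have hDab : D a b = 0 := by
    refine linearMap_eq_zero_of_monomials e he
      (cases_ac (fun x => D a b x = 0) (hN.right _ _) (fun i j => ?_) fun j => ?_) habb
    · simpa [hab, hba, hbaa, haba] using hD a b a (a ^ i * c ^ j)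
    · simpa [hab, hbc, hbcc, habc] using hD a b c (c ^ j)
  have hDcb : D c b = 0 := by
    refine linearMap_eq_zero_of_monomials e he
      (cases_ac (fun x => D c b x = 0) (hN.right _ _) (fun i j => ?_) fun j => ?_) hcbb
    · simpa [hcb, hba, hbaa, hcba] using hD c b a (a ^ i * c ^ j)
    · simpa [hcb, hbc, hbcc, hcbc] using hD c b c (c ^ j)
  have hDa : D a = 0 := by
    refine linearMap_eq_zero_of_monomials e he (fun i j => by ext z; exact haa i j z)
      (cases_b (fun x => D a x = 0) (by ext z; exact hN.mid _ _) fun k => ?_)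
    ext z
    simpa [hab, hbb, hDab] using hD a b (b ^ k) z
  have hDba : D b a = 0 := by
    refine linearMap_eq_zero_of_monomials e he hbaa
      (cases_b (fun x => D b a x = 0) (hN.right _ _) fun k => ?_)
    simpa [hab, hba, habb, hbab] using hD b a b (b ^ k)
  have hDb_a : ∀ i j : ℕ, D b (a * (a ^ i * c ^ j)) = 0 := by
    intro i j
    ext z
    simpa [hba, hDa, hDba] using hD b a (a ^ i * c ^ j) z
  have hDbc : D b c = 0 := by
    refine linearMap_eq_zero_of_monomials e he
      (cases_ac (fun x => D b c x = 0) (hN.right _ _) (fun i j => ?_)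
        fun j => by simpa only [pow_succ'] using hbcc (j + 1))
      (cases_b (fun x => D b c x = 0) (hN.right _ _) fun k => ?_)
    · have h := hDb_a 0 1
      simp only [pow_zero, pow_one, one_mul] at h
      simpa [hbc, hca, hcaa, hbca, h] using hD b c a (a ^ i * c ^ j)
    · simpa [hcb, hbc, hcbb, hbcb] using hD b c b (b ^ k)
  have hDb : D b = 0 := by
    refine linearMap_eq_zero_of_monomials e he
      (cases_ac (fun x => D b x = 0) (by ext z; exact hN.mid _ _) hDb_a fun j => ?_)
      (fun k => by ext z; exact hbb k z)
    ext z
    simpa [hbc, hcc, hDbc] using hD b c (c ^ j) z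
  have hDca : D c a = 0 := by
    refine linearMap_eq_zero_of_monomials e he hcaa
      (cases_b (fun x => D c a x = 0) (hN.right _ _) fun k => ?_)
    have h := hD a c b (b ^ k)
    simp only [hDa, hcbb, hcb, LinearMap.zero_apply, map_zero, mul_zero, zero_mul, add_zero,
      zero_add] at h
    simpa [hca, hab, habb, hcab, h] using hD c a b (b ^ k)
  have hDc : D c = 0 := by
    refine linearMap_eq_zero_of_monomials e he (fun i j => ?_)
      (cases_b (fun x => D c x = 0) (by ext z; exact hN.mid _ _) fun k => ?_)
    · induction i with
      | zero => ext z; simpa using hcc j z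
      | succ i ih =>
        ext z
        have h := hD a c (a ^ i * c ^ j) z
        simp only [hDa, ih, LinearMap.zero_apply, mul_zero, zero_mul, add_zero, zero_add] at h
        have h' := hD c a (a ^ i * c ^ j) z
        rw [pow_succ', mul_assoc]
        simpa [hca, hDa, hDca, h] using h'
    · ext z
      simpa [hcb, hbb, hDcb] using hD c b (b ^ k) z
  exact hD.eq_zero_of_generators e he (by ext y z; exact hN.left y z) hDa hDb hDc

/-- A grading of `F₂[a,b,c]/(ab,bc)` (with monomial basis `e`) for which `a`, `b`, `c` have degree
one. -/
structure IsPathGrading (a b c : A) (e : Module.Basis ((ℕ × ℕ) ⊕ ℕ) (ZMod 2) A)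
    (G : ℤ → Submodule (ZMod 2) A) : Prop where
  one_mem : 1 ∈ G 0
  a_mem : a ∈ G 1
  b_mem : b ∈ G 1
  c_mem : c ∈ G 1
  mul_mem {m n : ℤ} {x y : A} : x ∈ G m → y ∈ G n → x * y ∈ G (m + n)
  le_span (d : ℤ) : G d ≤ Submodule.span (ZMod 2) (e '' {m | (pathDegree m : ℤ) = d})

lemma IsPathGrading.map_mem {a b c : A} {e : Module.Basis ((ℕ × ℕ) ⊕ ℕ) (ZMod 2) A}
    {G : ℤ → Submodule (ZMod 2) A} (hG : IsPathGrading a b c e G)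
    (he : ∀ m, e m = pathMonomial a b c m) {φ : A →ₗ[ZMod 2] A} {s : ℤ}
    (hac : ∀ i j : ℕ, φ (a ^ i * c ^ j) ∈ G ((i + j : ℕ) + s))
    (hb : ∀ k : ℕ, φ (b ^ k) ∈ G (k + s)) {d : ℤ} {x : A} (hx : x ∈ G d) : φ x ∈ G (d + s) := by
  have h : Submodule.span (ZMod 2) (e '' {m | (pathDegree m : ℤ) = d}) ≤ (G (d + s)).comap φ := by
    rw [Submodule.span_le]
    rintro _ ⟨m, rfl, rfl⟩
    rw [he]
    rcases m with ⟨i, j⟩ | k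
    · exact hac i j
    · exact hb (k + 1)
  exact h (hG.le_span d hx)

lemma IsPathGrading.exists_of_mem_two {a b c : A} {e : Module.Basis ((ℕ × ℕ) ⊕ ℕ) (ZMod 2) A}
    {G : ℤ → Submodule (ZMod 2) A} (hG : IsPathGrading a b c e G)
    (he : ∀ m, e m = pathMonomial a b c m) {x : A} (hx : x ∈ G 2) :
    ∃ p q r s : ZMod 2, x = algebraMap _ A p * a ^ 2 + algebraMap _ A q * (a * c)
      + algebraMap _ A r * c ^ 2 + algebraMap _ A s * b ^ 2 := by
  have hset : e '' {m | (pathDegree m : ℤ) = 2} ⊆ {a ^ 2, a * c, c ^ 2, b ^ 2} := by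
    rintro _ ⟨m, hm, rfl⟩
    rw [he]
    rcases m with ⟨i, j⟩ | k
    · have hij : i + j = 2 := by exact_mod_cast hm
      have hi : i ≤ 2 := by omega
      interval_cases i
      · obtain rfl : j = 2 := by omega
        simp [pathMonomial]
      · obtain rfl : j = 1 := by omega
        simp [pathMonomial]
      · obtain rfl : j = 0 := by omega
        simp [pathMonomial]
    · have hk : k + 1 = 2 := by exact_mod_cast hm
      obtain rfl : k = 1 := by omega
      simp [pathMonomial]
  have h := Submodule.span_mono hset (hG.le_span 2 hx)
  simp only [Submodule.mem_span_insert, Submodule.mem_span_singleton] at h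
  obtain ⟨p, _, ⟨q, _, ⟨r, _, ⟨s, rfl⟩, rfl⟩, rfl⟩, rfl⟩ := h
  exact ⟨p, q, r, s, by simp only [Algebra.smul_def, add_assoc]⟩

lemma coeff_eq_zero_of_degree_three {a b c : A} {e : Module.Basis ((ℕ × ℕ) ⊕ ℕ) (ZMod 2) A}
    (he : ∀ m, e m = pathMonomial a b c m) {p q r s t : ZMod 2}
    (h : algebraMap _ A p * a ^ 3 + algebraMap _ A q * (a ^ 2 * c) + algebraMap _ A r * (a * c ^ 2)
      + algebraMap _ A s * c ^ 3 + algebraMap _ A t * b ^ 3 = 0) :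
    p = 0 ∧ q = 0 ∧ r = 0 ∧ s = 0 ∧ t = 0 := by
  have h1 : a ^ 3 = e (.inl (3, 0)) := by simp [he, pathMonomial]
  have h2 : a ^ 2 * c = e (.inl (2, 1)) := by simp [he, pathMonomial]
  have h3 : a * c ^ 2 = e (.inl (1, 2)) := by simp [he, pathMonomial]
  have h4 : c ^ 3 = e (.inl (0, 3)) := by simp [he, pathMonomial]
  have h5 : b ^ 3 = e (.inr 2) := by simp [he, pathMonomial]
  rw [h1, h2, h3, h4, h5] at h
  simp only [← Algebra.smul_def] at h
  have h' := congrArg e.repr h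
  simp only [map_add, map_smul, Module.Basis.repr_self, map_zero] at h'
  refine ⟨?_, ?_, ?_, ?_, ?_⟩
  · simpa using DFunLike.congr_fun h' (.inl (3, 0))
  · simpa using DFunLike.congr_fun h' (.inl (2, 1))
  · simpa using DFunLike.congr_fun h' (.inl (1, 2))
  · simpa using DFunLike.congr_fun h' (.inl (0, 3))
  · simpa using DFunLike.congr_fun h' (.inr 2)

/-- The Hochschild cohomology computed by the Koszul complex vanishes: a graded cocycle can be
corrected, by a choice of a 2-cochain on the non-normal words of length two, to vanish on the
Koszul chains of degree three. -/
lemma IsHochschildCocycle.exists_correction [CharP A 2]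
    {f : A →ₗ[ZMod 2] A →ₗ[ZMod 2] A →ₗ[ZMod 2] A} (hf : IsHochschildCocycle f)
    {a b c : A} (hab : a * b = 0) (hbc : b * c = 0)
    {e : Module.Basis ((ℕ × ℕ) ⊕ ℕ) (ZMod 2) A} (he : ∀ m, e m = pathMonomial a b c m)
    {G : ℤ → Submodule (ZMod 2) A} (hG : IsPathGrading a b c e G)
    (hfG : ∀ x y z, x ∈ G 1 → y ∈ G 1 → z ∈ G 1 → f x y z ∈ G 2) :
    ∃ gab ∈ G 1, ∃ gba ∈ G 1, ∃ gbc ∈ G 1, ∃ gcb ∈ G 1, ∃ gca ∈ G 1,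
      f a b a + a * gba + gab * a = 0 ∧ f a b c + a * gbc + gab * c = 0 ∧
      f c b a + c * gba + gcb * a = 0 ∧ f c b c + c * gbc + gcb * c = 0 ∧
      f b a b + b * gab + gba * b = 0 ∧ f b c b + b * gcb + gbc * b = 0 ∧
      f b c a + f b a c + b * gca + gbc * a + gba * c = 0 ∧
      f c a b + f a c b + c * gab + a * gcb + gca * b = 0 := by
  have hba : b * a = 0 := by rw [mul_comm, hab]
  have hcb : c * b = 0 := by rw [mul_comm, hbc]
  have hca : c * a = a * c := mul_comm c a
  have ha := hG.a_mem
  have hb := hG.b_mem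
  have hc := hG.c_mem
  obtain ⟨p1, p2, p3, p4, hp⟩ := hG.exists_of_mem_two he (hfG a b a ha hb ha)
  obtain ⟨q1, q2, q3, q4, hq⟩ := hG.exists_of_mem_two he (hfG a b c ha hb hc)
  obtain ⟨r1, r2, r3, r4, hr⟩ := hG.exists_of_mem_two he (hfG c b a hc hb ha)
  obtain ⟨s1, s2, s3, s4, hs⟩ := hG.exists_of_mem_two he (hfG c b c hc hb hc)
  obtain ⟨t1, t2, t3, t4, ht⟩ := hG.exists_of_mem_two he (hfG b a b hb ha hb)
  obtain ⟨u1, u2, u3, u4, hu⟩ := hG.exists_of_mem_two he (hfG b c b hb hc hb)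
  obtain ⟨x1, x2, x3, x4, hx⟩ := hG.exists_of_mem_two he
    (add_mem (hfG b c a hb hc ha) (hfG b a c hb ha hc))
  obtain ⟨y1, y2, y3, y4, hy⟩ := hG.exists_of_mem_two he
    (add_mem (hfG c a b hc ha hb) (hfG a c b ha hc hb))
  have two : (2 : A) = 0 := CharTwo.two_eq_zero
  have e1 := hf a b a b
  have e2 := hf c b c b
  have e3 := hf a b c b
  have e4 := hf c b a b
  have e5 : a * (f b c a + f b a c) + c * f a b a + a * f a b c = 0 := by
    have h1 := hf a b a c
    have h2 := hf a b c a
    simp only [hab, hba, hbc, hca, map_zero, LinearMap.zero_apply] at h1 h2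
    linear_combination h1 + h2 - f a b (a * c) * two
  have e6 : c * (f b c a + f b a c) + c * f c b a + a * f c b c = 0 := by
    have h1 := hf c b a c
    have h2 := hf c b c a
    simp only [hba, hbc, hcb, hca, map_zero, LinearMap.zero_apply] at h1 h2
    linear_combination h1 + h2 - f c b (a * c) * two
  have e7 : a * (f c a b + f a c b) + a * f c b a + c * f a b a = 0 := by
    have h1 := hf a c b a
    have h2 := hf c a b a
    simp only [hab, hba, hcb, hca, map_zero, LinearMap.zero_apply] at h1 h2
    linear_combination h1 + h2 - f (a * c) b a * two
  have e8 : c * (f c a b + f a c b) + a * f c b c + c * f a b c = 0 := by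
    have h1 := hf a c b c
    have h2 := hf c a b c
    simp only [hab, hbc, hcb, hca, map_zero, LinearMap.zero_apply] at h1 h2
    linear_combination h1 + h2 - f (a * c) b c * two
  have e9 : b * (f c a b + f a c b) + b * (f b c a + f b a c) = 0 := by
    have h1 := hf b a c b
    have h2 := hf b c a b
    simp only [hab, hba, hbc, hcb, hca, map_zero, LinearMap.zero_apply] at h1 h2
    linear_combination h1 + h2 - f b (a * c) b * two
  simp only [hab, hba, hbc, hcb, map_zero, LinearMap.zero_apply, add_zero] at e1 e2 e3 e4
  have hma (p q r s : A) : a * (p * a ^ 2 + q * (a * c) + r * c ^ 2 + s * b ^ 2)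
      = p * a ^ 3 + q * (a ^ 2 * c) + r * (a * c ^ 2) := by
    linear_combination s * b * hab
  have hmb (p q r s : A) : b * (p * a ^ 2 + q * (a * c) + r * c ^ 2 + s * b ^ 2) = s * b ^ 3 := by
    linear_combination (p * a + q * c) * hab + r * c * hbc
  have hmc (p q r s : A) : c * (p * a ^ 2 + q * (a * c) + r * c ^ 2 + s * b ^ 2)
      = p * (a ^ 2 * c) + q * (a * c ^ 2) + r * c ^ 3 := by
    linear_combination s * b * hbc
  rw [ht, hp, mul_comm _ b, hma, hmb] at e1
  rw [hu, hs, mul_comm _ b, hmc, hmb] at e2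
  rw [hu, hq, mul_comm _ b, hma, hmb] at e3
  rw [ht, hr, mul_comm _ b, hmc, hmb] at e4
  rw [hx, hp, hq, hma, hmc, hma] at e5
  rw [hx, hr, hs, hmc, hmc, hma] at e6
  rw [hy, hr, hp, hma, hma, hmc] at e7
  rw [hy, hs, hq, hmc, hma, hmc] at e8
  rw [hy, hx, hmb, hmb] at e9
  obtain ⟨rfl, rfl, rfl, -, rfl⟩ := coeff_eq_zero_of_degree_three he (e := e)
    (p := t1) (q := t2) (r := t3) (s := 0) (t := p4)
    (by simp only [map_zero]; linear_combination e1)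
  obtain ⟨-, rfl, rfl, rfl, rfl⟩ := coeff_eq_zero_of_degree_three he (e := e)
    (p := 0) (q := u1) (r := u2) (s := u3) (t := s4)
    (by simp only [map_zero]; linear_combination e2)
  obtain ⟨-, -, -, -, rfl⟩ := coeff_eq_zero_of_degree_three he (e := e)
    (p := 0) (q := 0) (r := 0) (s := 0) (t := q4)
    (by simp only [map_zero] at e3 ⊢; linear_combination e3)
  obtain ⟨-, -, -, -, rfl⟩ := coeff_eq_zero_of_degree_three he (e := e)
    (p := 0) (q := 0) (r := 0) (s := 0) (t := r4)
    (by simp only [map_zero] at e4 ⊢; linear_combination e4)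
  obtain ⟨a1, a2, a3, rfl, -⟩ := coeff_eq_zero_of_degree_three he (e := e)
    (p := x1 + q1) (q := x2 + p1 + q2) (r := x3 + p2 + q3) (s := p3) (t := 0)
    (by simp only [map_add, map_zero] at e5 ⊢; linear_combination e5)
  obtain ⟨rfl, b2, b3, b4, -⟩ := coeff_eq_zero_of_degree_three he (e := e)
    (p := s1) (q := x1 + r1 + s2) (r := x2 + r2 + s3) (s := x3 + r3) (t := 0)
    (by simp only [map_add, map_zero] at e6 ⊢; linear_combination e6)
  obtain ⟨c1, c2, c3, -, -⟩ := coeff_eq_zero_of_degree_three he (e := e)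
    (p := y1 + r1) (q := y2 + r2 + p1) (r := y3 + r3 + p2) (s := 0) (t := 0)
    (by simp only [map_add, map_zero] at e7 ⊢; linear_combination e7)
  obtain ⟨-, d2, d3, d4, -⟩ := coeff_eq_zero_of_degree_three he (e := e)
    (p := 0) (q := y1 + s2 + q1) (r := y2 + s3 + q2) (s := y3 + q3) (t := 0)
    (by simp only [map_add, map_zero] at e8 ⊢; linear_combination e8)
  obtain ⟨-, -, -, -, f5⟩ := coeff_eq_zero_of_degree_three he (e := e)
    (p := 0) (q := 0) (r := 0) (s := 0) (t := y4 + x4)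
    (by simp only [map_add, map_zero] at e9 ⊢; linear_combination e9)
  have hmem (k : ZMod 2) {x : A} (h : x ∈ G 1) : algebraMap _ A k * x ∈ G 1 := by
    rw [← Algebra.smul_def]
    exact Submodule.smul_mem _ _ h
  have two' : (2 : ZMod 2) = 0 := rfl
  obtain rfl : q1 = x1 := by linear_combination a1 - (x1) * two'
  obtain rfl : r3 = x3 := by linear_combination b4 - (x3) * two'
  obtain rfl : r1 = y1 := by linear_combination c1 - (y1) * two'
  obtain rfl : q3 = y3 := by linear_combination d4 - (y3) * two'
  obtain rfl : x4 = y4 := by linear_combination f5 - (y4) * two'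
  obtain rfl : q2 = x2 + p1 := by linear_combination a2 - (x2 + p1) * two'
  obtain rfl : p2 = r3 + q3 := by linear_combination a3 - (r3 + q3) * two'
  obtain rfl : s2 = q1 + r1 := by linear_combination b2 - (q1 + r1) * two'
  obtain rfl : s3 = x2 + r2 := by linear_combination b3 - (x2 + r2) * two'
  obtain rfl : y2 = r2 + p1 := by linear_combination c2 - (r2 + p1) * two'
  simp only [map_add, map_zero, zero_mul, add_zero, zero_add] at hp hq hr hs ht hu hx hy
  refine ⟨algebraMap _ A p1 * a + algebraMap _ A q3 * c + algebraMap _ A t4 * b,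
    add_mem (add_mem (hmem _ ha) (hmem _ hc)) (hmem _ hb),
    algebraMap _ A r3 * c, hmem _ hc,
    algebraMap _ A q1 * a + algebraMap _ A x2 * c, add_mem (hmem _ ha) (hmem _ hc),
    algebraMap _ A r1 * a + algebraMap _ A r2 * c + algebraMap _ A u4 * b,
    add_mem (add_mem (hmem _ ha) (hmem _ hc)) (hmem _ hb),
    algebraMap _ A x4 * b, hmem _ hb, ?_, ?_, ?_, ?_, ?_, ?_, ?_, ?_⟩
  · rw [hp]
    clear * - hab hbc two
    grind
  · rw [hq]
    clear * - hab hbc two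
    grind
  · rw [hr]
    clear * - hab hbc two
    grind
  · rw [hs]
    clear * - hab hbc two
    grind
  · rw [ht]
    clear * - hab hbc two
    grind
  · rw [hu]
    clear * - hab hbc two
    grind
  · rw [hx]
    clear * - hab hbc two
    grind
  · rw [hy]
    clear * - hab hbc two
    grind

/-- Linear maps out of `F₂[a,b,c]/(ab,bc)` can be defined by recursion on the length of
monomials. -/
lemma exists_linearMap_rec {M : Type*} [AddCommGroup M] [Module (ZMod 2) M]
    {a b c : A} {e : Module.Basis ((ℕ × ℕ) ⊕ ℕ) (ZMod 2) A} (he : ∀ m, e m = pathMonomial a b c m)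
    (m₀ : M) (stepa : ℕ → ℕ → M → M) (stepc stepb : ℕ → M → M) :
    ∃ φ : A →ₗ[ZMod 2] M, φ 1 = m₀ ∧
      (∀ i j : ℕ, φ (a * (a ^ i * c ^ j)) = stepa i j (φ (a ^ i * c ^ j))) ∧
      (∀ j : ℕ, φ (c * c ^ j) = stepc j (φ (c ^ j))) ∧
      (∀ k : ℕ, φ (b * b ^ k) = stepb k (φ (b ^ k))) := by
  let vc : ℕ → M := fun j => Nat.rec m₀ stepc j
  let vb : ℕ → M := fun k => Nat.rec m₀ stepb k
  let va : ℕ → ℕ → M := fun i j => Nat.rec (vc j) (fun i => stepa i j) i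
  let φ : A →ₗ[ZMod 2] M := e.constr (ZMod 2)
    (Sum.elim (fun p => va p.1 p.2) fun k => vb (k + 1))
  have hac (i j : ℕ) : φ (a ^ i * c ^ j) = va i j := by
    have := e.constr_basis (ZMod 2) (Sum.elim (fun p => va p.1 p.2) fun k => vb (k + 1)) (.inl (i, j))
    rwa [he] at this
  have hc (j : ℕ) : φ (c ^ j) = vc j := (congrArg φ (by simp)).trans (hac 0 j)
  have hb (k : ℕ) : φ (b ^ k) = vb k := by
    cases k with
    | zero => exact (congrArg φ (by simp)).trans (hac 0 0)
    | succ k =>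
      have := e.constr_basis (ZMod 2) (Sum.elim (fun p => va p.1 p.2) fun k => vb (k + 1)) (.inr k)
      rwa [he] at this
  refine ⟨φ, (congrArg φ (by simp)).trans (hc 0), fun i j => ?_, fun j => ?_, fun k => ?_⟩
  · rw [← mul_assoc, ← pow_succ', hac, hac]
  · rw [← pow_succ', hc, hc]
  · rw [← pow_succ', hb, hb]

lemma IsPathGrading.cast_mem {a b c : A} {e : Module.Basis ((ℕ × ℕ) ⊕ ℕ) (ZMod 2) A}
    {G : ℤ → Submodule (ZMod 2) A} (_ : IsPathGrading a b c e G) {d d' : ℤ} {x : A}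
    (hx : x ∈ G d) (h : d = d') : x ∈ G d' :=
  h ▸ hx

lemma IsPathGrading.pow_mem {a b c : A} {e : Module.Basis ((ℕ × ℕ) ⊕ ℕ) (ZMod 2) A}
    {G : ℤ → Submodule (ZMod 2) A} (hG : IsPathGrading a b c e G) {x : A} (hx : x ∈ G 1) (n : ℕ) :
    x ^ n ∈ G n := by
  induction n with
  | zero => simpa using hG.one_mem
  | succ n ih => exact pow_succ x n ▸ hG.cast_mem (hG.mul_mem ih hx) (by push_cast; ring)

/-- The vanishing of `HH^{3,-1}` of `F₂[a,b,c]/(ab,bc)` for normalized cocycles. -/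
theorem IsHochschildCocycle.exists_eq_hochschildD_of_normalized [CharP A 2]
    {f : A →ₗ[ZMod 2] A →ₗ[ZMod 2] A →ₗ[ZMod 2] A} (hf : IsHochschildCocycle f)
    (hN : IsNormalizedCochain f) {a b c : A} (hab : a * b = 0) (hbc : b * c = 0)
    {e : Module.Basis ((ℕ × ℕ) ⊕ ℕ) (ZMod 2) A} (he : ∀ m, e m = pathMonomial a b c m)
    {G : ℤ → Submodule (ZMod 2) A} (hG : IsPathGrading a b c e G)
    (hfG : ∀ d₁ d₂ d₃ x y z, x ∈ G d₁ → y ∈ G d₂ → z ∈ G d₃ → f x y z ∈ G (d₁ + d₂ + d₃ - 1)) :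
    ∃ g : A →ₗ[ZMod 2] A →ₗ[ZMod 2] A,
      (∀ d₁ d₂ x y, x ∈ G d₁ → y ∈ G d₂ → g x y ∈ G (d₁ + d₂ - 1)) ∧ f = hochschildD g := by
  have two : (2 : A) = 0 := CharTwo.two_eq_zero
  have hba : b * a = 0 := by rw [mul_comm, hab]
  have hcb : c * b = 0 := by rw [mul_comm, hbc]
  have ha := hG.a_mem
  have hb := hG.b_mem
  have hc := hG.c_mem
  have hbk := hG.pow_mem hb
  have hcj := hG.pow_mem hc
  have hij (i j : ℕ) : a ^ i * c ^ j ∈ G (i + j) := hG.mul_mem (hG.pow_mem ha i) (hcj j)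
  obtain ⟨gab, habG, gba, hbaG, gbc, hbcG, gcb, hcbG, gca, hcaG, haba, habc, hcba, hcbc, hbab,
    hbcb, hbca, hcab⟩ := hf.exists_correction hab hbc he hG (hfG 1 1 1)
  obtain ⟨gA, hA1, hAa, hAc, hAb⟩ := exists_linearMap_rec he (0 : A) (fun _ _ _ => 0)
    (fun _ _ => 0) (fun k _ => f a b (b ^ k) + gab * b ^ k)
  obtain ⟨gB, hB1, hBa, hBc, hBb⟩ := exists_linearMap_rec he (0 : A)
    (fun i j _ => f b a (a ^ i * c ^ j) + gba * (a ^ i * c ^ j))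
    (fun j _ => f b c (c ^ j) + gbc * c ^ j) (fun _ _ => 0)
  obtain ⟨gC, hC1, hCa, hCc, hCb⟩ := exists_linearMap_rec he (0 : A)
    (fun i j x => f c a (a ^ i * c ^ j) + f a c (a ^ i * c ^ j) + a * x + gca * (a ^ i * c ^ j))
    (fun _ _ => 0) (fun k _ => f c b (b ^ k) + gcb * b ^ k)
  have hAac (i j : ℕ) : gA (a ^ i * c ^ j) = 0 := by
    cases i with
    | succ i => rw [pow_succ', mul_assoc, hAa]
    | zero =>
      cases j with
      | zero => simpa using hA1
      | succ j => rw [pow_zero, one_mul, pow_succ', hAc]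
  have hBbk (k : ℕ) : gB (b ^ k) = 0 := by
    cases k with
    | zero => simpa using hB1
    | succ k => rw [pow_succ', hBb]
  have hCcj (j : ℕ) : gC (c ^ j) = 0 := by
    cases j with
    | zero => simpa using hC1
    | succ j => rw [pow_succ', hCc]
  have hgAb : gA b = gab := by simpa [hN.right] using hAb 0
  have hgBa : gB a = gba := by simpa [hN.right] using hBa 0 0
  have hgBc : gB c = gbc := by simpa [hN.right] using hBc 0
  have hgCb : gC b = gcb := by simpa [hN.right] using hCb 0
  have hgCa : gC a = gca := by simpa [hN.right, hC1] using hCa 0 0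
  have hAG {d : ℤ} {x : A} (hx : x ∈ G d) : gA x ∈ G (d + 0) := by
    refine hG.map_mem he (fun i j => by simp [hAac]) (fun k => ?_) hx
    cases k with
    | zero => simp [hA1]
    | succ k =>
      rw [pow_succ', hAb]
      exact add_mem (hG.cast_mem (hfG _ _ _ _ _ _ ha hb (hbk k)) (by push_cast; ring))
        (hG.cast_mem (hG.mul_mem habG (hbk k)) (by push_cast; ring))
  have hBG {d : ℤ} {x : A} (hx : x ∈ G d) : gB x ∈ G (d + 0) := by
    refine hG.map_mem he (fun i j => ?_) (fun k => by simp [hBbk]) hx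
    cases i with
    | zero =>
      cases j with
      | zero => simp [hB1]
      | succ j =>
        rw [pow_zero, one_mul, pow_succ', hBc]
        exact add_mem (hG.cast_mem (hfG _ _ _ _ _ _ hb hc (hcj j)) (by push_cast; ring))
          (hG.cast_mem (hG.mul_mem hbcG (hcj j)) (by push_cast; ring))
    | succ i =>
      rw [pow_succ', mul_assoc, hBa]
      exact add_mem (hG.cast_mem (hfG _ _ _ _ _ _ hb ha (hij i j)) (by push_cast; ring))
        (hG.cast_mem (hG.mul_mem hbaG (hij i j)) (by push_cast; ring))
  have hCG {d : ℤ} {x : A} (hx : x ∈ G d) : gC x ∈ G (d + 0) := by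
    refine hG.map_mem he (fun i j => ?_) (fun k => ?_) hx
    · induction i with
      | zero => simp [hCcj]
      | succ i ih =>
        rw [pow_succ', mul_assoc, hCa]
        exact add_mem (add_mem (add_mem
          (hG.cast_mem (hfG _ _ _ _ _ _ hc ha (hij i j)) (by push_cast; ring))
          (hG.cast_mem (hfG _ _ _ _ _ _ ha hc (hij i j)) (by push_cast; ring)))
          (hG.cast_mem (hG.mul_mem ha ih) (by push_cast; ring)))
          (hG.cast_mem (hG.mul_mem hcaG (hij i j)) (by push_cast; ring))
    · cases k with
      | zero => simp [hC1]
      | succ k =>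
        rw [pow_succ', hCb]
        exact add_mem (hG.cast_mem (hfG _ _ _ _ _ _ hc hb (hbk k)) (by push_cast; ring))
          (hG.cast_mem (hG.mul_mem hcbG (hbk k)) (by push_cast; ring))
  obtain ⟨g, hg1, hga, hgc, hgb⟩ := exists_linearMap_rec he (0 : A →ₗ[ZMod 2] A)
    (fun i j φ => f a (a ^ i * c ^ j) + LinearMap.mulLeft (ZMod 2) a ∘ₗ φ
      + gA ∘ₗ LinearMap.mulLeft (ZMod 2) (a ^ i * c ^ j))
    (fun j φ => f c (c ^ j) + LinearMap.mulLeft (ZMod 2) c ∘ₗ φ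
      + gC ∘ₗ LinearMap.mulLeft (ZMod 2) (c ^ j))
    (fun k φ => f b (b ^ k) + LinearMap.mulLeft (ZMod 2) b ∘ₗ φ
      + gB ∘ₗ LinearMap.mulLeft (ZMod 2) (b ^ k))
  have hga' (i j : ℕ) (z : A) : g (a * (a ^ i * c ^ j)) z
      = f a (a ^ i * c ^ j) z + a * g (a ^ i * c ^ j) z + gA (a ^ i * c ^ j * z) := by
    simp [hga, mul_assoc]
  have hgc' (j : ℕ) (z : A) : g (c * c ^ j) z = f c (c ^ j) z + c * g (c ^ j) z + gC (c ^ j * z) := by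
    simp [hgc]
  have hgb' (k : ℕ) (z : A) : g (b * b ^ k) z = f b (b ^ k) z + b * g (b ^ k) z + gB (b ^ k * z) := by
    simp [hgb]
  have hgA : g a = gA := by ext z; simpa [hN.mid, hg1] using hga' 0 0 z
  have hgB : g b = gB := by ext z; simpa [hN.mid, hg1] using hgb' 0 z
  have hgC : g c = gC := by ext z; simpa [hN.mid, hg1] using hgc' 0 z
  have hgac (z : A) : g (a * c) z = f a c z + a * gC z + gA (c * z) := by
    simpa [hgC] using hga' 0 1 z
  have hright (x : A) : g x 1 = 0 := by
    have : g.flip 1 = 0 := by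
      refine linearMap_eq_zero_of_monomials e he (fun i j => ?_) (fun k => ?_)
      · rw [LinearMap.flip_apply]
        induction i with
        | zero =>
          rw [pow_zero, one_mul]
          induction j with
          | zero => simp [hg1]
          | succ j ih => rw [pow_succ', hgc', hN.right, ih, mul_one, hCcj]; simp
        | succ i ih => rw [pow_succ', mul_assoc, hga', hN.right, ih, mul_one, hAac]; simp
      · rw [LinearMap.flip_apply]
        induction k with
        | zero => simp [hg1]
        | succ k ih => rw [pow_succ', hgb', hN.right, ih, mul_one, hBbk]; simp
    exact DFunLike.congr_fun this x
  refine ⟨g, fun d₁ d₂ x y hx hy => ?_, ?_⟩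
  · have : g.flip y x ∈ G (d₁ + (d₂ - 1)) := by
      refine hG.map_mem he (fun i j => ?_) (fun k => ?_) hx
      · rw [LinearMap.flip_apply]
        induction i with
        | zero =>
          rw [pow_zero, one_mul]
          induction j with
          | zero => simp [hg1]
          | succ j ih =>
            rw [pow_succ', hgc']
            exact add_mem (add_mem
              (hG.cast_mem (hfG _ _ _ _ _ _ hc (hcj j) hy) (by push_cast; ring))
              (hG.cast_mem (hG.mul_mem hc ih) (by push_cast; ring)))
              (hG.cast_mem (hCG (hG.mul_mem (hcj j) hy)) (by push_cast; ring))
        | succ i ih =>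
          rw [pow_succ', mul_assoc, hga']
          exact add_mem (add_mem
            (hG.cast_mem (hfG _ _ _ _ _ _ ha (hij i j) hy) (by push_cast; ring))
            (hG.cast_mem (hG.mul_mem ha ih) (by push_cast; ring)))
            (hG.cast_mem (hAG (hG.mul_mem (hij i j) hy)) (by push_cast; ring))
      · rw [LinearMap.flip_apply]
        induction k with
        | zero => simp [hg1]
        | succ k ih =>
          rw [pow_succ', hgb']
          exact add_mem (add_mem
            (hG.cast_mem (hfG _ _ _ _ _ _ hb (hbk k) hy) (by push_cast; ring))
            (hG.cast_mem (hG.mul_mem hb ih) (by push_cast; ring)))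
            (hG.cast_mem (hBG (hG.mul_mem (hbk k) hy)) (by push_cast; ring))
    exact hG.cast_mem this (by ring)
  have hD : f + hochschildD g = 0 := by
    have hDN : IsNormalizedCochain (f + hochschildD g) := by
      refine ⟨fun y z => ?_, fun x z => ?_, fun x y => ?_⟩
      · simp only [LinearMap.add_apply, hochschildD_apply, hN.left, hg1, LinearMap.zero_apply, one_mul]
        linear_combination g y z * two
      · simp only [LinearMap.add_apply, hochschildD_apply, hN.mid, hg1, hright,
          LinearMap.zero_apply, mul_one, one_mul]
        linear_combination g x z * two
      · simp only [LinearMap.add_apply, hochschildD_apply, hN.right, hright, mul_one]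
        linear_combination g x y * two
    refine (hf.add_hochschildD g).eq_zero_of_cells hDN hab hbc e he (fun i j z => ?_)
      (fun j z => ?_) (fun k z => ?_) (fun k => ?_) (fun k => ?_) (fun i j => ?_) (fun j => ?_)
      (fun i j => ?_) ?_ ?_ ?_ ?_ ?_ ?_ ?_ ?_ <;>
      simp only [LinearMap.add_apply, hochschildD_apply]
    · rw [hga', hgA, hAac]
      linear_combination (f a (a ^ i * c ^ j) z + a * g (a ^ i * c ^ j) z
        + gA (a ^ i * c ^ j * z)) * two
    · rw [hgc', hgC, hCcj]
      linear_combination (f c (c ^ j) z + c * g (c ^ j) z + gC (c ^ j * z)) * two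
    · rw [hgb', hgB, hBbk]
      linear_combination (f b (b ^ k) z + b * g (b ^ k) z + gB (b ^ k * z)) * two
    · rw [hab, map_zero, LinearMap.zero_apply, hgB, hBbk, hgA, hAb, hgAb]
      linear_combination (f a b (b ^ k) + gab * b ^ k) * two
    · rw [hcb, map_zero, LinearMap.zero_apply, hgB, hBbk, hgC, hCb, hgCb]
      linear_combination (f c b (b ^ k) + gcb * b ^ k) * two
    · rw [hba, map_zero, LinearMap.zero_apply, hgA, hAac, hgB, hBa, hgBa]
      linear_combination (f b a (a ^ i * c ^ j) + gba * (a ^ i * c ^ j)) * two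
    · rw [hbc, map_zero, LinearMap.zero_apply, hgC, hCcj, hgB, hBc, hgBc]
      linear_combination (f b c (c ^ j) + gbc * c ^ j) * two
    · have hAca : gA (c * (a ^ i * c ^ j)) = 0 := by
        rw [mul_left_comm, ← pow_succ', hAac]
      rw [mul_comm c a, hgac, hAca, hgA, hAac, hgC, hCa, hgCa]
      linear_combination (f c a (a ^ i * c ^ j) + f a c (a ^ i * c ^ j) + a * gC (a ^ i * c ^ j)
        + gca * (a ^ i * c ^ j)) * two
    · rw [hab, hba, hgB, hgA, hgBa, hgAb, map_zero, map_zero, LinearMap.zero_apply]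
      linear_combination haba
    · rw [hab, hbc, hgB, hgA, hgBc, hgAb, map_zero, map_zero, LinearMap.zero_apply]
      linear_combination habc
    · rw [hcb, hba, hgB, hgC, hgBa, hgCb, map_zero, map_zero, LinearMap.zero_apply]
      linear_combination hcba
    · rw [hcb, hbc, hgB, hgC, hgBc, hgCb, map_zero, map_zero, LinearMap.zero_apply]
      linear_combination hcbc
    · rw [hba, hab, hgA, hgB, hgAb, hgBa, map_zero, map_zero, LinearMap.zero_apply]
      linear_combination hbab
    · rw [hbc, hcb, hgC, hgB, hgCb, hgBc, map_zero, map_zero, LinearMap.zero_apply]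
      linear_combination hbcb
    · have hBac : gB (a * c) = f b a c + gba * c := by simpa using hBa 0 1
      rw [hbc, mul_comm c a, hgC, hgB, hBac, hgCa, hgBc, map_zero, LinearMap.zero_apply]
      linear_combination hbca
    · rw [hab, mul_comm c a, hgac, hcb, hgA, hgC, hgAb, hgCa, hgCb, map_zero, map_zero]
      linear_combination hcab
  ext x y z
  have := DFunLike.congr_fun (DFunLike.congr_fun (DFunLike.congr_fun hD x) y) z
  simp only [LinearMap.add_apply, LinearMap.zero_apply] at this
  exact CharTwo.add_eq_zero.1 this

lemma hochschildD_add (g g' : A →ₗ[ZMod 2] A →ₗ[ZMod 2] A) :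
    hochschildD (g + g') = hochschildD g + hochschildD g' := by
  ext x y z
  simp only [LinearMap.add_apply, hochschildD_apply]
  ring

/-- The vanishing of `HH^{3,-1}` of `F₂[a,b,c]/(ab,bc)`. -/
theorem IsHochschildCocycle.exists_eq_hochschildD [CharP A 2]
    {f : A →ₗ[ZMod 2] A →ₗ[ZMod 2] A →ₗ[ZMod 2] A} (hf : IsHochschildCocycle f)
    {a b c : A} (hab : a * b = 0) (hbc : b * c = 0)
    {e : Module.Basis ((ℕ × ℕ) ⊕ ℕ) (ZMod 2) A} (he : ∀ m, e m = pathMonomial a b c m)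
    {G : ℤ → Submodule (ZMod 2) A} (hG : IsPathGrading a b c e G)
    (hfG : ∀ d₁ d₂ d₃ x y z, x ∈ G d₁ → y ∈ G d₂ → z ∈ G d₃ → f x y z ∈ G (d₁ + d₂ + d₃ - 1)) :
    ∃ g : A →ₗ[ZMod 2] A →ₗ[ZMod 2] A,
      (∀ d₁ d₂ x y, x ∈ G d₁ → y ∈ G d₂ → g x y ∈ G (d₁ + d₂ - 1)) ∧ f = hochschildD g := by
  have two : (2 : A) = 0 := CharTwo.two_eq_zero
  have hDG (g : A →ₗ[ZMod 2] A →ₗ[ZMod 2] A)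
      (hg : ∀ d₁ d₂ x y, x ∈ G d₁ → y ∈ G d₂ → g x y ∈ G (d₁ + d₂ - 1)) (d₁ d₂ d₃ : ℤ) (x y z : A)
      (hx : x ∈ G d₁) (hy : y ∈ G d₂) (hz : z ∈ G d₃) :
      hochschildD g x y z ∈ G (d₁ + d₂ + d₃ - 1) := by
    rw [hochschildD_apply]
    exact add_mem (add_mem (add_mem
      (hG.cast_mem (hG.mul_mem hx (hg _ _ _ _ hy hz)) (by ring))
      (hG.cast_mem (hg _ _ _ _ (hG.mul_mem hx hy) hz) (by ring)))
      (hG.cast_mem (hg _ _ _ _ hx (hG.mul_mem hy hz)) (by ring)))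
      (hG.cast_mem (hG.mul_mem (hg _ _ _ _ hx hy) hz) (by ring))
  set f₁ := f + hochschildD (f 1) with hf₁
  have hc₁ : IsHochschildCocycle f₁ := hf.add_hochschildD _
  have hG₁ : ∀ d₁ d₂ x y, x ∈ G d₁ → y ∈ G d₂ → f 1 x y ∈ G (d₁ + d₂ - 1) := fun d₁ d₂ x y hx hy =>
    hG.cast_mem (hfG _ _ _ _ _ _ hG.one_mem hx hy) (by ring)
  have hl₁ (y z : A) : f₁ 1 y z = 0 := by
    have := hf 1 1 y z
    simp only [one_mul] at this
    simp only [hf₁, LinearMap.add_apply, hochschildD_apply, one_mul]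
    linear_combination this
  set g₂ : A →ₗ[ZMod 2] A →ₗ[ZMod 2] A := f₁.flip 1 with hg₂
  have hG₂ : ∀ d₁ d₂ x y, x ∈ G d₁ → y ∈ G d₂ → g₂ x y ∈ G (d₁ + d₂ - 1) := fun d₁ d₂ x y hx hy =>
    add_mem (hG.cast_mem (hfG _ _ _ _ _ _ hx hG.one_mem hy) (by ring))
      (hG.cast_mem (hDG _ hG₁ _ _ _ _ _ _ hx hG.one_mem hy) (by ring))
  set f₂ := f₁ + hochschildD g₂ with hf₂
  have hc₂ : IsHochschildCocycle f₂ := hc₁.add_hochschildD _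
  have hl₂ (y z : A) : f₂ 1 y z = 0 := by
    simp only [hf₂, hg₂, LinearMap.add_apply, hochschildD_apply, LinearMap.flip_apply, one_mul, hl₁]
    linear_combination f₁ y 1 z * two
  have hm₂ (x z : A) : f₂ x 1 z = 0 := by
    have := hc₁ x 1 1 z
    simp only [one_mul, mul_one] at this
    simp only [hf₂, hg₂, LinearMap.add_apply, hochschildD_apply, LinearMap.flip_apply, one_mul,
      mul_one]
    linear_combination this
  have hr₂ (x y : A) : f₂ x y 1 = 0 := by
    have := hc₂ x y 1 1
    simp only [mul_one, hm₂, mul_zero] at this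
    linear_combination this - f₂ x y 1 * two
  obtain ⟨g₃, hG₃, h₃⟩ := hc₂.exists_eq_hochschildD_of_normalized ⟨hl₂, hm₂, hr₂⟩ hab hbc he hG
    fun d₁ d₂ d₃ x y z hx hy hz => add_mem (add_mem (hfG _ _ _ _ _ _ hx hy hz)
      (hDG _ hG₁ _ _ _ _ _ _ hx hy hz)) (hDG _ hG₂ _ _ _ _ _ _ hx hy hz)
  refine ⟨f 1 + g₂ + g₃, fun d₁ d₂ x y hx hy =>
    add_mem (add_mem (hG₁ _ _ _ _ hx hy) (hG₂ _ _ _ _ hx hy)) (hG₃ _ _ _ _ hx hy), ?_⟩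
  rw [hochschildD_add, hochschildD_add, ← h₃, hf₂, hf₁]
  ext x y z
  simp only [LinearMap.add_apply]
  generalize hochschildD (f 1) x y z = u
  generalize hochschildD g₂ x y z = v
  linear_combination - (u + v) * two

end PathAlgebra

section Aalg

open MvPolynomial

/-- The generators `a`, `b`, `c` of `A = F₂[a,b,c]/(ab,bc)`. -/
noncomputable abbrev Aalg.gen (i : Fin 3) : Aalg := Ideal.Quotient.mk Irel (X i)

lemma mem_Irel_iff {p : Apoly} :
    p ∈ Irel ↔ ∀ s ∈ p.support, (s 0 ≠ 0 ∧ s 1 ≠ 0) ∨ (s 1 ≠ 0 ∧ s 2 ≠ 0) := by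
  have h : Irel = Ideal.span ((fun s : Fin 3 →₀ ℕ => monomial s (1 : Ftwo)) ''
      {Finsupp.single 0 1 + Finsupp.single 1 1, Finsupp.single 1 1 + Finsupp.single 2 1}) := by
    simp [Irel, Set.image_pair, X, monomial_mul]
  rw [h, mem_ideal_span_monomial_image]
  simp [Finsupp.le_def, Fin.forall_fin_succ, Nat.one_le_iff_ne_zero]

lemma Aalg.zero_mul_one : Aalg.gen 0 * Aalg.gen 1 = 0 := by
  rw [← map_mul, Ideal.Quotient.eq_zero_iff_mem]
  exact Ideal.subset_span (by simp)

lemma Aalg.one_mul_two : Aalg.gen 1 * Aalg.gen 2 = 0 := by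
  rw [← map_mul, Ideal.Quotient.eq_zero_iff_mem]
  exact Ideal.subset_span (by simp)

/-- The exponent of a monomial of `A = F₂[a,b,c]/(ab,bc)`. -/
noncomputable def pathExponent : (ℕ × ℕ) ⊕ ℕ → Fin 3 →₀ ℕ
  | .inl (i, j) => Finsupp.single 0 i + Finsupp.single 2 j
  | .inr k => Finsupp.single 1 (k + 1)

lemma pathExponent_injective : Function.Injective pathExponent := by
  rintro (⟨i, j⟩ | k) (⟨i', j'⟩ | k') h
  all_goals
    have h0 := DFunLike.congr_fun h 0
    have h1 := DFunLike.congr_fun h 1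
    have h2 := DFunLike.congr_fun h 2
    simp [pathExponent] at h0 h1 h2
  · simp [h0, h2]
  · simp [h1]

lemma pathMonomial_eq_mk (m : (ℕ × ℕ) ⊕ ℕ) : pathMonomial (Aalg.gen 0) (Aalg.gen 1) (Aalg.gen 2) m
    = Ideal.Quotient.mk Irel (monomial (pathExponent m) 1) := by
  rcases m with ⟨i, j⟩ | k
  · simp [pathMonomial, pathExponent, Aalg.gen, X_pow_eq_monomial, ← map_pow, ← map_mul, monomial_mul]
  · simp [pathMonomial, pathExponent, Aalg.gen, X_pow_eq_monomial, ← map_pow]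

lemma linearIndependent_pathMonomial :
    LinearIndependent Ftwo (pathMonomial (Aalg.gen 0) (Aalg.gen 1) (Aalg.gen 2)) := by
  rw [linearIndependent_iff']
  intro s g hg m hm
  by_contra hgm
  have hmem : ∑ i ∈ s, monomial (pathExponent i) (g i) ∈ Irel := by
    rw [← Ideal.Quotient.eq_zero_iff_mem, map_sum, ← hg]
    refine Finset.sum_congr rfl fun i _ => ?_
    rw [pathMonomial_eq_mk, ← Ideal.Quotient.mkₐ_eq_mk Ftwo, ← map_smul, smul_monomial, smul_eq_mul,
      mul_one]
  have hcoeff : coeff (pathExponent m) (∑ i ∈ s, monomial (pathExponent i) (g i)) = g m := by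
    rw [coeff_sum, Finset.sum_eq_single m]
    · simp
    · intro i _ hi
      rw [coeff_monomial, if_neg fun h => hi (pathExponent_injective h)]
    · exact fun h => absurd hm h
  have := mem_Irel_iff.1 hmem (pathExponent m) (by rw [mem_support_iff, hcoeff]; exact hgm)
  rcases m with ⟨i, j⟩ | k <;> simp [pathExponent] at this

lemma mk_monomial_mem_span (s : Fin 3 →₀ ℕ) (r : Ftwo) :
    Ideal.Quotient.mk Irel (monomial s r) ∈ Submodule.span Ftwo
      (pathMonomial (Aalg.gen 0) (Aalg.gen 1) (Aalg.gen 2) '' {m | pathDegree m = s.degree}) := by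
  by_cases h : (s 0 ≠ 0 ∧ s 1 ≠ 0) ∨ (s 1 ≠ 0 ∧ s 2 ≠ 0)
  · have : monomial s r ∈ Irel := mem_Irel_iff.2 fun t ht => by
      rw [mem_support_iff, coeff_monomial] at ht
      rwa [← (ite_ne_right_iff.1 ht).1]
    rw [Ideal.Quotient.eq_zero_iff_mem.2 this]
    exact zero_mem _
  · obtain ⟨m, rfl⟩ : ∃ m, pathExponent m = s := by
      by_cases h1 : s 1 = 0
      · refine ⟨.inl (s 0, s 2), ?_⟩
        ext i
        fin_cases i <;> simp [pathExponent, h1]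
      · refine ⟨.inr (s 1 - 1), ?_⟩
        ext i
        fin_cases i <;> simp [pathExponent] <;> omega
    have : Ideal.Quotient.mk Irel (monomial (pathExponent m) r)
        = r • pathMonomial (Aalg.gen 0) (Aalg.gen 1) (Aalg.gen 2) m := by
      rw [pathMonomial_eq_mk, ← Ideal.Quotient.mkₐ_eq_mk Ftwo, ← map_smul, smul_monomial,
        smul_eq_mul, mul_one]
    rw [this]
    refine Submodule.smul_mem _ _ (Submodule.subset_span ⟨m, ?_, rfl⟩)
    rcases m with ⟨i, j⟩ | k <;> simp [pathExponent, pathDegree]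

lemma span_pathMonomial :
    ⊤ ≤ Submodule.span Ftwo (Set.range (pathMonomial (Aalg.gen 0) (Aalg.gen 1) (Aalg.gen 2))) := by
  intro x _
  obtain ⟨p, rfl⟩ := Ideal.Quotient.mk_surjective x
  rw [p.as_sum, map_sum]
  exact sum_mem fun s _ => Submodule.span_mono (Set.image_subset_range _ _)
    (mk_monomial_mem_span s _)

lemma mem_AG_natCast {n : ℕ} {x : Aalg} :
    x ∈ AG n ↔ ∃ p : Apoly, p.IsHomogeneous n ∧ Ideal.Quotient.mk Irel p = x := by
  simp [AG, Submodule.mem_map]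

lemma isPathGrading_AG {e : Module.Basis ((ℕ × ℕ) ⊕ ℕ) (ZMod 2) Aalg}
    (he : ∀ m, e m = pathMonomial (Aalg.gen 0) (Aalg.gen 1) (Aalg.gen 2) m) :
    IsPathGrading (Aalg.gen 0) (Aalg.gen 1) (Aalg.gen 2) e AG where
  one_mem := mem_AG_natCast (n := 0).2 ⟨1, isHomogeneous_one _ _, map_one _⟩
  a_mem := mem_AG_natCast (n := 1).2 ⟨X 0, isHomogeneous_X _ _, rfl⟩
  b_mem := mem_AG_natCast (n := 1).2 ⟨X 1, isHomogeneous_X _ _, rfl⟩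
  c_mem := mem_AG_natCast (n := 1).2 ⟨X 2, isHomogeneous_X _ _, rfl⟩
  mul_mem {m n x y} hx hy := by
    by_cases hm : 0 ≤ m
    · by_cases hn : 0 ≤ n
      · lift m to ℕ using hm
        lift n to ℕ using hn
        obtain ⟨p, hp, rfl⟩ := mem_AG_natCast.1 hx
        obtain ⟨q, hq, rfl⟩ := mem_AG_natCast.1 hy
        exact mem_AG_natCast (n := m + n).2 ⟨p * q, hp.mul hq, map_mul _ _ _⟩
      · rw [AG, if_neg hn, Submodule.mem_bot] at hy
        simp [hy]
    · rw [AG, if_neg hm, Submodule.mem_bot] at hx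
      simp [hx]
  le_span d x hx := by
    by_cases hd : 0 ≤ d
    · lift d to ℕ using hd
      obtain ⟨p, hp, rfl⟩ := mem_AG_natCast.1 hx
      rw [p.as_sum, map_sum]
      refine sum_mem fun s hs => ?_
      have hsd : s.degree = d := by
        by_contra h
        exact mem_support_iff.1 hs (hp.coeff_eq_zero h)
      have := mk_monomial_mem_span s (coeff s p)
      rw [hsd] at this
      simpa [funext he] using this
    · rw [AG, if_neg hd, Submodule.mem_bot] at hx
      rw [hx]
      exact zero_mem _

end Aalg

/-- **Statement 8.** Let `A = F₂[a,b,c]/(ab,bc)` with `a, b, c` in degree `1`.  The graded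
Hochschild cohomology group `HH^{3,−1}(A)` vanishes: in the reduced Hochschild cochain
complex of `F₂`-linear maps of internal degree `−1`, with differential
`∂(f)(a₁⊗⋯⊗a_{n+1}) = a₁f(a₂⊗⋯⊗a_{n+1}) + Σᵢ f(a₁⊗⋯⊗aᵢaᵢ₊₁⊗⋯⊗a_{n+1}) + f(a₁⊗⋯⊗aₙ)a_{n+1}`,
the sequence `Hom(A^{⊗2}, A)_{−1} → Hom(A^{⊗3}, A)_{−1} → Hom(A^{⊗4}, A)_{−1}` is exact
at the middle term: every degree-`(−1)` graded map `f : A^{⊗3} → A` with `∂f = 0` is of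
the form `∂g` for a degree-`(−1)` graded map `g : A^{⊗2} → A`.  (Since pure tensors span
`A^{⊗4}`, the condition `∂f = 0` is expressed pointwise, as is `f = ∂g`.) -/
theorem stmt8 (f : Aalg ⊗[Ftwo] (Aalg ⊗[Ftwo] Aalg) →ₗ[Ftwo] Aalg)
    (hgraded : ∀ (d₁ d₂ d₃ : ℤ) (x₁ x₂ x₃ : Aalg),
      x₁ ∈ AG d₁ → x₂ ∈ AG d₂ → x₃ ∈ AG d₃ →
        f (x₁ ⊗ₜ (x₂ ⊗ₜ x₃)) ∈ AG (d₁ + d₂ + d₃ - 1))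
    (hcocycle : ∀ x₁ x₂ x₃ x₄ : Aalg,
      x₁ * f (x₂ ⊗ₜ (x₃ ⊗ₜ x₄)) + f ((x₁ * x₂) ⊗ₜ (x₃ ⊗ₜ x₄))
        + f (x₁ ⊗ₜ ((x₂ * x₃) ⊗ₜ x₄)) + f (x₁ ⊗ₜ (x₂ ⊗ₜ (x₃ * x₄)))
        + f (x₁ ⊗ₜ (x₂ ⊗ₜ x₃)) * x₄ = 0) :
    ∃ g : Aalg ⊗[Ftwo] Aalg →ₗ[Ftwo] Aalg,
      (∀ (d₁ d₂ : ℤ) (x₁ x₂ : Aalg), x₁ ∈ AG d₁ → x₂ ∈ AG d₂ →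
        g (x₁ ⊗ₜ x₂) ∈ AG (d₁ + d₂ - 1)) ∧
      ∀ x₁ x₂ x₃ : Aalg,
        f (x₁ ⊗ₜ (x₂ ⊗ₜ x₃)) =
          x₁ * g (x₂ ⊗ₜ x₃) + g ((x₁ * x₂) ⊗ₜ x₃) + g (x₁ ⊗ₜ (x₂ * x₃)) + g (x₁ ⊗ₜ x₂) * x₃ := by
  have : Nontrivial Aalg := linearIndependent_pathMonomial.nontrivial
  have : CharP Aalg 2 := charP_of_injective_algebraMap (algebraMap Ftwo Aalg).injective 2
  let e := Module.Basis.mk linearIndependent_pathMonomial span_pathMonomial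
  have he (m) : e m = pathMonomial (Aalg.gen 0) (Aalg.gen 1) (Aalg.gen 2) m :=
    Module.Basis.mk_apply _ _ m
  let F : Aalg →ₗ[Ftwo] Aalg →ₗ[Ftwo] Aalg →ₗ[Ftwo] Aalg :=
    TensorProduct.lcurry (.id Ftwo) Aalg Aalg Aalg ∘ₗ TensorProduct.curry f
  obtain ⟨g, hg, hF⟩ := IsHochschildCocycle.exists_eq_hochschildD (f := F) hcocycle
    Aalg.zero_mul_one Aalg.one_mul_two he (isPathGrading_AG he) hgraded
  refine ⟨TensorProduct.lift g, hg, fun x₁ x₂ x₃ => ?_⟩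
  change F x₁ x₂ x₃ = _
  rw [hF, hochschildD_apply]
  simp only [TensorProduct.lift.tmul]
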